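/- arXiv:2203.17238 — 2 statements merged into one kernel-verified Lean document; each statement's English description precedes it below -/
import Mathlib

section
/- Let d ∈ ℝ, p₀ᵢ > 0, p₀ⱼ > 0 and pᵢⱼ ∈ ℝ with pᵢⱼ² < p₀ᵢ p₀ⱼ. Define κ, λ(c), αₙ(θ), βₙ(θ) by κ = (2π √(p₀ᵢ p₀ⱼ − pᵢⱼ²))^{-1}, λ(c)(wᵢ, wⱼ) = −[(wᵢ+c)² p₀ⱼ + (wⱼ+c)² p₀ᵢ − 2 pᵢⱼ (wᵢ+c)(wⱼ+c)] / (2(p₀ᵢ p₀ⱼ − pᵢⱼ²)), αₙ(θ) = d(p₀ᵢ sin θ + p₀ⱼ cos θ − pᵢⱼ(cos θ + sin θ))/(p₀ᵢ p₀ⱼ − pᵢⱼ²), βₙ(θ) = (p₀ⱼ cos² θ + p₀ᵢ sin² θ − pᵢⱼ sin 2θ)/(2(p₀ᵢ p₀ⱼ − pᵢⱼ²)). Then ∫_{ℝ²} sgn(wᵢ) sgn(wⱼ) κ e^{λ(d)(wᵢ,wⱼ)} dwᵢ dwⱼ = [exp(−d²(p₀ᵢ + p₀ⱼ − 2pᵢⱼ)/(2(p₀ᵢ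 p₀ⱼ − pᵢⱼ²))) / (π √(p₀ᵢ p₀ⱼ − pᵢⱼ²))] · ∫_0^{π/2} [ 1/βₙ(θ) + √(π/βₙ(θ)) · (αₙ(θ)/(2βₙ(θ))) · e^{αₙ(θ)²/(4βₙ(θ))} − √(π/βₙ(θ)) · (αₙ(θ)/βₙ(θ)) · Q(αₙ(θ)/√(2βₙ(θ))) · e^{αₙ(θ)²/(4βₙ(θ))} ] dθ − 1, where Q(x) = (1/√(2π)) ∫_x^{∞} e^{-z²/2} dz and sgn(w) = 1 for w > 0 and −1 for w < 0. -/
open Real MeasureTheory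

/-- The Gaussian tail function `Q(x) = (1/√(2π)) ∫_x^∞ e^{-z²/2} dz`. -/
noncomputable def gaussQ (x : ℝ) : ℝ :=
  (1 / Real.sqrt (2 * Real.pi)) * ∫ z in Set.Ioi x, Real.exp (-z ^ 2 / 2)

/-- The exponent `λ(c)(wᵢ, wⱼ)` of the bivariate Gaussian density with mean `(-c,-c)`
and covariance `[[p₀ᵢ, pᵢⱼ], [pᵢⱼ, p₀ⱼ]]`. -/
noncomputable def lam (p0i p0j pij c wi wj : ℝ) : ℝ :=
  -((wi + c) ^ 2 * p0j + (wj + c) ^ 2 * p0i - 2 * pij * (wi + c) * (wj + c)) /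
    (2 * (p0i * p0j - pij ^ 2))

/-- `αₙ(θ)` from equation (115). -/
noncomputable def alphaN (p0i p0j pij d θ : ℝ) : ℝ :=
  d * (p0i * Real.sin θ + p0j * Real.cos θ - pij * (Real.cos θ + Real.sin θ)) /
    (p0i * p0j - pij ^ 2)

/-- `βₙ(θ)` from equation (115). -/
noncomputable def betaN (p0i p0j pij θ : ℝ) : ℝ :=
  (p0j * Real.cos θ ^ 2 + p0i * Real.sin θ ^ 2 - pij * Real.sin (2 * θ)) /
    (2 * (p0i * p0j - pij ^ 2))

/-- The map `r ↦ e^{-βr² - αr}` is a shifted Gaussian up to a constant factor. -/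
lemma exp_quadratic_eq_shift {β : ℝ} (hβ : 0 < β) (α r : ℝ) :
    exp (-β * r ^ 2 - α * r) =
      exp (α ^ 2 / (4 * β)) * exp (-β * (r + α / (2 * β)) ^ 2) := by
  rw [← exp_add]
  congr 1
  field_simp
  ring

lemma integrable_exp_quadratic {β : ℝ} (hβ : 0 < β) (α : ℝ) :
    Integrable fun r : ℝ => exp (-β * r ^ 2 - α * r) := by
  simp_rw [exp_quadratic_eq_shift hβ α]
  exact ((integrable_exp_neg_mul_sq hβ).comp_add_right _).const_mul _

lemma integrable_mul_exp_quadratic {β : ℝ} (hβ : 0 < β) (α : ℝ) :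
    Integrable fun r : ℝ => r * exp (-β * r ^ 2 - α * r) := by
  have h := (((integrable_mul_exp_neg_mul_sq hβ).comp_add_right (α / (2 * β))).const_mul
    (exp (α ^ 2 / (4 * β)))).sub ((integrable_exp_quadratic hβ α).const_mul (α / (2 * β)))
  refine h.congr (ae_of_all _ fun r => ?_)
  simp only [Pi.sub_apply, exp_quadratic_eq_shift hβ α]
  ring

lemma tendsto_exp_quadratic_atTop {β : ℝ} (hβ : 0 < β) (α : ℝ) :
    Filter.Tendsto (fun r : ℝ => exp (-β * r ^ 2 - α * r)) Filter.atTop (nhds 0) := by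
  have h : Filter.Tendsto (fun r : ℝ => (β * r + α) * r) Filter.atTop Filter.atTop :=
    (Filter.tendsto_atTop_add_const_right _ _
      (Filter.tendsto_id.const_mul_atTop hβ)).atTop_mul_atTop₀ Filter.tendsto_id
  refine (tendsto_exp_neg_atTop_nhds_zero.comp h).congr fun r => ?_
  simp only [Function.comp_apply]
  ring_nf

/-- The half-line first moment of `e^{-βr² - αr}` in terms of its half-line integral. -/
lemma integral_Ioi_mul_exp_quadratic {β : ℝ} (hβ : 0 < β) (α : ℝ) :
    ∫ r in Set.Ioi (0 : ℝ), r * exp (-β * r ^ 2 - α * r) =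
      1 / (2 * β) - α / (2 * β) * ∫ r in Set.Ioi (0 : ℝ), exp (-β * r ^ 2 - α * r) := by
  have h0 := (integrable_exp_quadratic hβ α).integrableOn (s := Set.Ioi 0)
  have h1 := (integrable_mul_exp_quadratic hβ α).integrableOn (s := Set.Ioi 0)
  have hd : ∀ r ∈ Set.Ici (0 : ℝ), HasDerivAt (fun r : ℝ => exp (-β * r ^ 2 - α * r))
      (-(2 * β) * (r * exp (-β * r ^ 2 - α * r)) - α * exp (-β * r ^ 2 - α * r)) r := by
    intro r _
    have h := (((hasDerivAt_pow 2 r).const_mul (-β)).sub ((hasDerivAt_id r).const_mul α)).exp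
    refine h.congr_deriv ?_
    simp
    ring
  have h := integral_Ioi_of_hasDerivAt_of_tendsto' hd
    ((h1.const_mul _).sub (h0.const_mul _)) (tendsto_exp_quadratic_atTop hβ α)
  rw [integral_sub (h1.const_mul _) (h0.const_mul _), integral_const_mul,
    integral_const_mul] at h
  simp only [ne_eq, OfNat.ofNat_ne_zero, not_false_eq_true, zero_pow, mul_zero, sub_zero,
    exp_zero] at h
  generalize (∫ r in Set.Ioi (0 : ℝ), r * exp (-β * r ^ 2 - α * r)) = I₁ at h ⊢
  generalize (∫ r in Set.Ioi (0 : ℝ), exp (-β * r ^ 2 - α * r)) = I₀ at h ⊢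
  field_simp
  linarith

lemma integral_Ioi_comp_add_right (g : ℝ → ℝ) (a c : ℝ) :
    ∫ x in Set.Ioi a, g (x + c) = ∫ x in Set.Ioi (a + c), g x := by
  have h := (measurePreserving_add_right volume c).setIntegral_preimage_emb
    (measurableEmbedding_addRight c) g (Set.Ioi (a + c))
  simpa using h

/-- The half-line integral of `e^{-βr² - αr}` in terms of the Gaussian tail function. -/
lemma integral_Ioi_exp_quadratic {β : ℝ} (hβ : 0 < β) (α : ℝ) :
    ∫ r in Set.Ioi (0 : ℝ), exp (-β * r ^ 2 - α * r) =
      √(π / β) * gaussQ (α / √(2 * β)) * exp (α ^ 2 / (4 * β)) := by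
  have hs : 0 < √(2 * β) := sqrt_pos.mpr (by positivity)
  have hs2 : √(2 * β) ^ 2 = 2 * β := sq_sqrt (by positivity)
  have hshift : √(2 * β) * (α / (2 * β)) = α / √(2 * β) := by
    field_simp
    rw [hs2]
  have hconst : √(π / β) * (1 / √(2 * π)) = (√(2 * β))⁻¹ := by
    rw [sqrt_div pi_pos.le, sqrt_mul zero_le_two, sqrt_mul zero_le_two]
    have := sqrt_pos.mpr pi_pos
    field_simp
  have hg : ∀ x : ℝ, exp (-β * x ^ 2) = exp (-(√(2 * β) * x) ^ 2 / 2) := by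
    intro x
    rw [mul_pow, hs2]
    ring_nf
  simp_rw [exp_quadratic_eq_shift hβ α]
  rw [integral_const_mul, integral_Ioi_comp_add_right (fun x => exp (-β * x ^ 2))]
  simp_rw [hg]
  rw [integral_comp_mul_left_Ioi (fun x => exp (-x ^ 2 / 2)) _ hs, zero_add, hshift, gaussQ,
    smul_eq_mul, ← mul_assoc (√(π / β)), hconst]
  ring

lemma gaussQ_add_gaussQ_neg (x : ℝ) : gaussQ x + gaussQ (-x) = 1 := by
  have hi : Integrable fun z : ℝ => exp (-z ^ 2 / 2) := by
    refine (integrable_exp_neg_mul_sq (b := 1 / 2) (by norm_num)).congr (ae_of_all _ fun z => ?_)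
    simp only
    ring_nf
  have ht : ∫ z : ℝ, exp (-z ^ 2 / 2) = √(2 * π) := by
    have h := integral_gaussian (1 / 2)
    rw [show π / (1 / 2) = 2 * π by ring] at h
    rw [← h]
    congr 1
    ext z
    ring_nf
  have hn := integral_comp_neg_Iic x (fun z => exp (-z ^ 2 / 2))
  simp only [neg_sq] at hn
  have hadd := intervalIntegral.integral_Iic_add_Ioi (b := x) hi.integrableOn hi.integrableOn
  have hp : 0 < √(2 * π) := sqrt_pos.mpr (by positivity)
  rw [gaussQ, gaussQ, ← hn, ← mul_add, add_comm, hadd, ht]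
  field_simp

/-- The radial integral along a full line through the origin. -/
lemma integral_Ioi_mul_exp_quadratic_add_neg {β : ℝ} (hβ : 0 < β) (α : ℝ) :
    (∫ r in Set.Ioi (0 : ℝ), r * exp (-β * r ^ 2 - α * r)) +
      (∫ r in Set.Ioi (0 : ℝ), r * exp (-β * r ^ 2 - (-α) * r)) =
      1 / β + √(π / β) * (α / (2 * β)) * exp (α ^ 2 / (4 * β))
        - √(π / β) * (α / β) * gaussQ (α / √(2 * β)) * exp (α ^ 2 / (4 * β)) := by
  rw [integral_Ioi_mul_exp_quadratic hβ, integral_Ioi_mul_exp_quadratic hβ,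
    integral_Ioi_exp_quadratic hβ, integral_Ioi_exp_quadratic hβ, neg_div √(2 * β) α,
    ← sub_eq_of_eq_add' (gaussQ_add_gaussQ_neg (α / √(2 * β))).symm, neg_sq]
  field_simp
  ring

lemma polarCoord_symm_image_quadrant :
    polarCoord.symm '' (Set.Ioi 0 ×ˢ Set.Ioo 0 (π / 2)) = Set.Ioi (0 : ℝ) ×ˢ Set.Ioi (0 : ℝ) := by
  ext q
  constructor
  · rintro ⟨⟨r, θ⟩, ⟨hr, h0, h1⟩, rfl⟩
    simp only [Set.mem_Ioi] at hr h0 h1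
    exact ⟨mul_pos hr (cos_pos_of_mem_Ioo ⟨by linarith, h1⟩),
      mul_pos hr (sin_pos_of_mem_Ioo ⟨h0, by linarith⟩)⟩
  · rintro ⟨hx, hy⟩
    have hq : q ∈ polarCoord.source := Or.inl hx
    have hleft := polarCoord.left_inv hq
    have ht := polarCoord.map_source hq
    generalize polarCoord q = p at hleft ht
    subst hleft
    obtain ⟨r, θ⟩ := p
    obtain ⟨hr, h0, h1⟩ := ht
    simp only [polarCoord_symm_apply, Set.mem_Ioi] at hr h0 h1 hx hy
    have hc := pos_of_mul_pos_right hx hr.le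
    have hs := pos_of_mul_pos_right hy hr.le
    refine ⟨(r, θ), ⟨hr, ?_, ?_⟩, rfl⟩
    · by_contra! h
      exact absurd hs (sin_nonpos_of_nonpos_of_neg_pi_le h h0.le).not_gt
    · by_contra! h
      exact absurd hc (cos_nonpos_of_pi_div_two_le_of_le h (by linarith)).not_gt

lemma measurableSet_polar_quadrant :
    MeasurableSet (Set.Ioi (0 : ℝ) ×ˢ Set.Ioo (0 : ℝ) (π / 2)) :=
  measurableSet_Ioi.prod measurableSet_Ioo

lemma injOn_polarCoord_symm_quadrant :
    Set.InjOn polarCoord.symm (Set.Ioi (0 : ℝ) ×ˢ Set.Ioo (0 : ℝ) (π / 2)) := by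
  refine polarCoord.symm.injOn.mono ?_
  rintro ⟨r, θ⟩ ⟨hr, h0, h1⟩
  simp only at h0 h1
  exact ⟨hr, by simp only; linarith, by simp only; linarith⟩

lemma integrableOn_polar_quadrant {f : ℝ × ℝ → ℝ}
    (hf : IntegrableOn f (Set.Ioi 0 ×ˢ Set.Ioi 0)) :
    IntegrableOn (fun p : ℝ × ℝ => p.1 * f (p.1 * cos p.2, p.1 * sin p.2))
      (Set.Ioi 0 ×ˢ Set.Ioo 0 (π / 2)) := by
  rw [← polarCoord_symm_image_quadrant, integrableOn_image_iff_integrableOn_abs_det_fderiv_smul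
    volume measurableSet_polar_quadrant
    (fun p _ => (hasFDerivAt_polarCoord_symm p).hasFDerivWithinAt)
    injOn_polarCoord_symm_quadrant] at hf
  refine hf.congr_fun (fun p hp => ?_) measurableSet_polar_quadrant
  simp only [det_fderivPolarCoordSymm, abs_of_pos (show 0 < p.1 from hp.1), smul_eq_mul,
    polarCoord_symm_apply]

lemma integrableOn_integral_polar_quadrant {f : ℝ × ℝ → ℝ}
    (hf : IntegrableOn f (Set.Ioi 0 ×ˢ Set.Ioi 0)) :
    IntegrableOn (fun θ : ℝ => ∫ r in Set.Ioi (0 : ℝ), r * f (r * cos θ, r * sin θ))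
      (Set.Ioo 0 (π / 2)) := by
  have h := integrableOn_polar_quadrant hf
  rw [IntegrableOn, Measure.volume_eq_prod, ← Measure.prod_restrict] at h
  exact h.integral_prod_right

/-- Integration in polar coordinates over the open first quadrant. -/
lemma setIntegral_quadrant_eq_polar {f : ℝ × ℝ → ℝ}
    (hf : IntegrableOn f (Set.Ioi 0 ×ˢ Set.Ioi 0)) :
    ∫ q in Set.Ioi (0 : ℝ) ×ˢ Set.Ioi (0 : ℝ), f q =
      ∫ θ in Set.Ioo 0 (π / 2), ∫ r in Set.Ioi (0 : ℝ), r * f (r * cos θ, r * sin θ) := by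
  have h := integrableOn_polar_quadrant hf
  rw [← polarCoord_symm_image_quadrant, integral_image_eq_integral_abs_det_fderiv_smul
    volume measurableSet_polar_quadrant
    (fun p _ => (hasFDerivAt_polarCoord_symm p).hasFDerivWithinAt)
    injOn_polarCoord_symm_quadrant]
  rw [IntegrableOn, Measure.volume_eq_prod, ← Measure.prod_restrict] at h
  refine Eq.trans ?_ (integral_prod_symm _ h)
  rw [Measure.prod_restrict, ← Measure.volume_eq_prod]
  refine setIntegral_congr_fun measurableSet_polar_quadrant fun p hp => ?_
  simp only [det_fderivPolarCoordSymm, abs_of_pos (show 0 < p.1 from hp.1), smul_eq_mul,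
    polarCoord_symm_apply]

lemma setIntegral_neg_quadrant (f : ℝ × ℝ → ℝ) :
    ∫ q in Set.Iio (0 : ℝ) ×ˢ Set.Iio (0 : ℝ), f q =
      ∫ q in Set.Ioi (0 : ℝ) ×ˢ Set.Ioi (0 : ℝ), f (-q) := by
  have h := (Measure.measurePreserving_neg (volume : Measure (ℝ × ℝ))).setIntegral_preimage_emb
    (Homeomorph.neg (ℝ × ℝ)).measurableEmbedding f (Set.Iio 0 ×ˢ Set.Iio 0)
  rw [← h]
  congr 2
  ext q
  simp

/-- The expectation of a product of signs through the mass of the two diagonal quadrants. -/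
lemma integral_sign_mul_sign {f : ℝ × ℝ → ℝ} (hf : Integrable f) :
    ∫ x : ℝ, ∫ y : ℝ, Real.sign x * Real.sign y * f (x, y) =
      2 * ((∫ q in Set.Ioi (0 : ℝ) ×ˢ Set.Ioi (0 : ℝ), f q) +
        ∫ q in Set.Iio (0 : ℝ) ×ˢ Set.Iio (0 : ℝ), f q) - ∫ q, f q := by
  have hP : MeasurableSet (Set.Ioi (0 : ℝ) ×ˢ Set.Ioi (0 : ℝ)) :=
    measurableSet_Ioi.prod measurableSet_Ioi
  have hN : MeasurableSet (Set.Iio (0 : ℝ) ×ˢ Set.Iio (0 : ℝ)) :=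
    measurableSet_Iio.prod measurableSet_Iio
  have hsum : Integrable fun q => 2 * ((Set.Ioi 0 ×ˢ Set.Ioi 0).indicator f q +
      (Set.Iio 0 ×ˢ Set.Iio 0).indicator f q) :=
    ((hf.indicator hP).add (hf.indicator hN)).const_mul 2
  have hne : ∀ᵐ x : ℝ, x ≠ 0 := compl_mem_ae_iff.mpr (measure_singleton 0)
  rw [← integral_indicator hP, ← integral_indicator hN,
    ← integral_add (hf.indicator hP) (hf.indicator hN), ← integral_const_mul,
    ← integral_sub hsum hf, Measure.volume_eq_prod, integral_prod]
  · refine integral_congr_ae (hne.mono fun x hx => integral_congr_ae (hne.mono fun y hy => ?_))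
    rcases hx.lt_or_gt with hx | hx <;> rcases hy.lt_or_gt with hy | hy <;>
      simp [Set.indicator, Real.sign_of_neg, Real.sign_of_pos, hx, hy, hx.not_gt, hy.not_gt] <;>
      ring
  · exact hsum.sub hf

lemma lam_le {p0i p0j pij : ℝ} (hi : 0 < p0i) (hj : 0 < p0j) (hij : pij ^ 2 < p0i * p0j)
    (c x y : ℝ) :
    lam p0i p0j pij c x y ≤ -(1 / (2 * (p0i + p0j))) * (x + c) ^ 2
      + -(1 / (2 * (p0i + p0j))) * (y + c) ^ 2 := by
  have hD : 0 < p0i * p0j - pij ^ 2 := sub_pos.mpr hij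
  have key : -(1 / (2 * (p0i + p0j))) * (x + c) ^ 2 + -(1 / (2 * (p0i + p0j))) * (y + c) ^ 2
      - lam p0i p0j pij c x y =
      ((p0j * (x + c) - pij * (y + c)) ^ 2 + (p0i * (y + c) - pij * (x + c)) ^ 2) /
        (2 * (p0i + p0j) * (p0i * p0j - pij ^ 2)) := by
    rw [lam]
    have hT : p0i + p0j ≠ 0 := by positivity
    field_simp
    ring
  have : 0 ≤ ((p0j * (x + c) - pij * (y + c)) ^ 2 + (p0i * (y + c) - pij * (x + c)) ^ 2) /
        (2 * (p0i + p0j) * (p0i * p0j - pij ^ 2)) := by positivity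
  linarith

lemma integrable_exp_lam {p0i p0j pij : ℝ} (hi : 0 < p0i) (hj : 0 < p0j)
    (hij : pij ^ 2 < p0i * p0j) (c : ℝ) :
    Integrable fun q : ℝ × ℝ => exp (lam p0i p0j pij c q.1 q.2) := by
  have h := (integrable_exp_neg_mul_sq
    (b := 1 / (2 * (p0i + p0j))) (by positivity)).comp_add_right c
  refine (h.mul_prod h).mono' (Continuous.aestronglyMeasurable ?_) (ae_of_all _ fun q => ?_)
  · unfold lam
    fun_prop
  · rw [norm_of_nonneg (exp_pos _).le, ← exp_add]
    exact exp_le_exp.mpr (lam_le hi hj hij c q.1 q.2)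

lemma integral_exp_lam {p0i p0j pij : ℝ} (hi : 0 < p0i) (hj : 0 < p0j)
    (hij : pij ^ 2 < p0i * p0j) (c : ℝ) :
    ∫ q : ℝ × ℝ, exp (lam p0i p0j pij c q.1 q.2) = 2 * π * √(p0i * p0j - pij ^ 2) := by
  have hD : 0 < p0i * p0j - pij ^ 2 := sub_pos.mpr hij
  have hcomplete : ∀ x y : ℝ, exp (lam p0i p0j pij c x y) =
      exp (-(1 / (2 * p0i)) * (x + c) ^ 2) *
        exp (-(p0i / (2 * (p0i * p0j - pij ^ 2))) * (y + (c - pij * (x + c) / p0i)) ^ 2) := by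
    intro x y
    rw [← exp_add, lam]
    congr 1
    generalize hDelta : p0i * p0j - pij ^ 2 = Δ at hD
    obtain rfl : p0j = (Δ + pij ^ 2) / p0i := by
      field_simp
      linarith
    field_simp
    ring
  have h := integrable_exp_lam hi hj hij c
  rw [Measure.volume_eq_prod] at h ⊢
  rw [integral_prod _ h]
  simp_rw [hcomplete, integral_const_mul]
  simp_rw [fun a : ℝ => integral_add_right_eq_self (μ := volume)
    (fun y : ℝ => exp (-(p0i / (2 * (p0i * p0j - pij ^ 2))) * y ^ 2)) a]
  rw [integral_mul_const, integral_add_right_eq_self (μ := volume)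
    (fun x : ℝ => exp (-(1 / (2 * p0i)) * x ^ 2)), integral_gaussian, integral_gaussian,
    ← sqrt_mul (by positivity), show π / (1 / (2 * p0i)) *
      (π / (p0i / (2 * (p0i * p0j - pij ^ 2)))) = (2 * π) ^ 2 * (p0i * p0j - pij ^ 2) by
      field_simp, sqrt_mul (by positivity), sqrt_sq (by positivity)]

lemma betaN_pos {p0i p0j pij : ℝ} (hi : 0 < p0i) (hj : 0 < p0j) (hij : pij ^ 2 < p0i * p0j)
    (θ : ℝ) : 0 < betaN p0i p0j pij θ := by
  have hD : 0 < p0i * p0j - pij ^ 2 := sub_pos.mpr hij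
  have h := lam_le hi hj hij 0 (cos θ) (sin θ)
  have hb : betaN p0i p0j pij θ = -lam p0i p0j pij 0 (cos θ) (sin θ) := by
    rw [betaN, lam, sin_two_mul]
    ring
  have hpos : 0 < 1 / (2 * (p0i + p0j)) := by positivity
  rw [hb]
  nlinarith [cos_sq_add_sin_sq θ]

lemma lam_polar (p0i p0j pij d r θ : ℝ) :
    lam p0i p0j pij d (r * cos θ) (r * sin θ) =
      -d ^ 2 * (p0i + p0j - 2 * pij) / (2 * (p0i * p0j - pij ^ 2)) +
        (-betaN p0i p0j pij θ * r ^ 2 - alphaN p0i p0j pij d θ * r) := by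
  rw [lam, betaN, alphaN, sin_two_mul, mul_comm 2 (p0i * p0j - pij ^ 2)]
  simp only [← div_div]
  ring

lemma lam_neg (p0i p0j pij d x y : ℝ) :
    lam p0i p0j pij d (-x) (-y) = lam p0i p0j pij (-d) x y := by
  rw [lam, lam]
  ring

lemma alphaN_neg (p0i p0j pij d θ : ℝ) :
    alphaN p0i p0j pij (-d) θ = -alphaN p0i p0j pij d θ := by
  rw [alphaN, alphaN]
  ring

lemma integral_Ioi_mul_exp_lam_polar (p0i p0j pij d θ : ℝ) :
    ∫ r in Set.Ioi (0 : ℝ), r * exp (lam p0i p0j pij d (r * cos θ) (r * sin θ)) =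
      exp (-d ^ 2 * (p0i + p0j - 2 * pij) / (2 * (p0i * p0j - pij ^ 2))) *
        ∫ r in Set.Ioi (0 : ℝ),
          r * exp (-betaN p0i p0j pij θ * r ^ 2 - alphaN p0i p0j pij d θ * r) := by
  rw [← integral_const_mul]
  congr 1
  ext r
  rw [lam_polar, exp_add]
  ring

/-- Theorem 1 (equation (114)): the autocorrelation of the one-bit sampled data
`R_y(i,j) = E[sgn Wᵢ sgn Wⱼ]` for `(Wᵢ, Wⱼ)` bivariate Gaussian with mean `(-d,-d)`
and covariance `[[p₀ᵢ, pᵢⱼ], [pᵢⱼ, p₀ⱼ]]`. -/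
theorem modified_arcsine_nonstationary (d p0i p0j pij : ℝ) (hi : 0 < p0i) (hj : 0 < p0j)
    (hij : pij ^ 2 < p0i * p0j) :
    (∫ wi : ℝ, ∫ wj : ℝ, Real.sign wi * Real.sign wj *
        ((2 * Real.pi * Real.sqrt (p0i * p0j - pij ^ 2))⁻¹ *
          Real.exp (lam p0i p0j pij d wi wj)))
      = Real.exp (-d ^ 2 * (p0i + p0j - 2 * pij) / (2 * (p0i * p0j - pij ^ 2))) /
          (Real.pi * Real.sqrt (p0i * p0j - pij ^ 2)) *
        (∫ θ in (0 : ℝ)..(Real.pi / 2),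
          1 / betaN p0i p0j pij θ
          + Real.sqrt (Real.pi / betaN p0i p0j pij θ) *
              (alphaN p0i p0j pij d θ / (2 * betaN p0i p0j pij θ)) *
              Real.exp (alphaN p0i p0j pij d θ ^ 2 / (4 * betaN p0i p0j pij θ))
          - Real.sqrt (Real.pi / betaN p0i p0j pij θ) *
              (alphaN p0i p0j pij d θ / betaN p0i p0j pij θ) *
              gaussQ (alphaN p0i p0j pij d θ / Real.sqrt (2 * betaN p0i p0j pij θ)) *
              Real.exp (alphaN p0i p0j pij d θ ^ 2 / (4 * betaN p0i p0j pij θ)))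
        - 1 := by
  have hD : 0 < √(p0i * p0j - pij ^ 2) := sqrt_pos.mpr (sub_pos.mpr hij)
  have hnormalize : ∀ E I : ℝ, (2 * π * √(p0i * p0j - pij ^ 2))⁻¹ *
      (2 * (E * I) - 2 * π * √(p0i * p0j - pij ^ 2)) =
      E / (π * √(p0i * p0j - pij ^ 2)) * I - 1 := by
    intro E I
    field_simp
  have hint := integrable_exp_lam hi hj hij
  have hsign := integral_sign_mul_sign (hint d)
  rw [setIntegral_neg_quadrant] at hsign
  simp only [Prod.fst_neg, Prod.snd_neg, lam_neg] at hsign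
  rw [integral_exp_lam hi hj hij, setIntegral_quadrant_eq_polar (hint d).integrableOn,
    setIntegral_quadrant_eq_polar (hint (-d)).integrableOn,
    ← integral_add (integrableOn_integral_polar_quadrant (hint d).integrableOn)
      (integrableOn_integral_polar_quadrant (hint (-d)).integrableOn)] at hsign
  simp only [integral_Ioi_mul_exp_lam_polar, alphaN_neg, neg_sq] at hsign
  simp_rw [← mul_add, fun θ => integral_Ioi_mul_exp_quadratic_add_neg
    (betaN_pos hi hj hij θ) (alphaN p0i p0j pij d θ)] at hsign
  rw [integral_const_mul] at hsign
  simp_rw [mul_left_comm _ (2 * π * √(p0i * p0j - pij ^ 2))⁻¹, integral_const_mul]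
  rw [hsign, intervalIntegral.integral_of_le (by positivity), integral_Ioc_eq_integral_Ioo]
  exact hnormalize _ _
end

section
/- Let p₀ᵢ > 0, p₀ⱼ > 0 and pᵢⱼ ∈ ℝ with pᵢⱼ² < p₀ᵢ p₀ⱼ, and define βₙ(θ) = (p₀ⱼ cos² θ + p₀ᵢ sin² θ − pᵢⱼ sin 2θ)/(2(p₀ᵢ p₀ⱼ − pᵢⱼ²)). Then ∫_0^{π/2} 1/βₙ(θ) dθ = √(p₀ᵢ p₀ⱼ − pᵢⱼ²) · ( π + 2 arcsin( pᵢⱼ / √(p₀ᵢ p₀ⱼ) ) ). -/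
open Real MeasureTheory

/-- The quadratic form `a x² + b y² - 2 c x y` is positive on the unit circle when `c² < a b`. -/
theorem betaN_numerator_pos {a b c : ℝ} (hb : 0 < b) (hc : c ^ 2 < b * a) (θ : ℝ) :
    0 < a * Real.cos θ ^ 2 + b * Real.sin θ ^ 2 - c * Real.sin (2 * θ) := by
  have hsc := Real.sin_sq_add_cos_sq θ
  rw [Real.sin_two_mul]
  refine pos_of_mul_pos_right (a := b) ?_ hb.le
  have hsq : b * (a * Real.cos θ ^ 2 + b * Real.sin θ ^ 2 - c * (2 * Real.sin θ * Real.cos θ)) =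
      (b * Real.sin θ - c * Real.cos θ) ^ 2 + (b * a - c ^ 2) * Real.cos θ ^ 2 := by ring
  rw [hsq]
  rcases eq_or_ne (Real.cos θ) 0 with h | h
  · have hs : Real.sin θ ≠ 0 := by
      intro hs
      simp [h, hs] at hsc
    rw [h]
    simp only [mul_zero, sub_zero]
    positivity
  · have : 0 < b * a - c ^ 2 := by linarith
    positivity

theorem hasDerivAt_arctan_tan_primitive {a b c θ : ℝ} (hb : 0 < b) (hc : c ^ 2 < b * a)
    (hθ : Real.cos θ ≠ 0) :
    HasDerivAt (fun x => 2 * √(b * a - c ^ 2) *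
        Real.arctan ((b * Real.tan x - c) / √(b * a - c ^ 2)))
      (1 / betaN b a c θ) θ := by
  have hD : 0 < b * a - c ^ 2 := by linarith
  have hs : 0 < √(b * a - c ^ 2) := Real.sqrt_pos.mpr hD
  have hN := betaN_numerator_pos hb hc θ
  have hsq : √(b * a - c ^ 2) ^ 2 = b * a - c ^ 2 := Real.sq_sqrt hD.le
  have h := ((((Real.hasDerivAt_tan hθ).const_mul b).sub_const c).div_const
    √(b * a - c ^ 2)).arctan.const_mul (2 * √(b * a - c ^ 2))
  refine h.congr_deriv (Eq.symm ?_)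
  rw [betaN, one_div_div]
  rw [Real.sin_two_mul] at hN ⊢
  rw [Real.tan_eq_sin_div_cos]
  generalize √(b * a - c ^ 2) = s at *
  have hden : s ^ 2 * Real.cos θ ^ 2 + (b * Real.sin θ - c * Real.cos θ) ^ 2 =
      b * (a * Real.cos θ ^ 2 + b * Real.sin θ ^ 2 - c * (2 * Real.sin θ * Real.cos θ)) := by
    rw [hsq]; ring
  have hfrac : 1 + ((b * (Real.sin θ / Real.cos θ) - c) / s) ^ 2 =
      b * (a * Real.cos θ ^ 2 + b * Real.sin θ ^ 2 - c * (2 * Real.sin θ * Real.cos θ)) /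
        (s ^ 2 * Real.cos θ ^ 2) := by
    rw [← hden]; field_simp
  rw [hfrac, ← hsq]
  generalize a * Real.cos θ ^ 2 + b * Real.sin θ ^ 2 - c * (2 * Real.sin θ * Real.cos θ) = N at *
  field_simp

theorem arcsin_div_sqrt_eq_arctan {m c : ℝ} (hc : c ^ 2 < m) :
    Real.arcsin (c / √m) = Real.arctan (c / √(m - c ^ 2)) := by
  have hm : 0 < m := (sq_nonneg c).trans_lt hc
  have hsm : 0 < √m := Real.sqrt_pos.mpr hm
  have hlt : |c / √m| < 1 := by
    rw [← sq_lt_one_iff_abs_lt_one, div_pow, Real.sq_sqrt hm.le, div_lt_one hm]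
    exact hc
  have hsqrt : √(1 - (c / √m) ^ 2) = √(m - c ^ 2) / √m := by
    rw [div_pow, Real.sq_sqrt hm.le, ← Real.sqrt_div (by linarith), sub_div, div_self hm.ne']
  rw [Real.arcsin_eq_arctan (abs_lt.mp hlt), hsqrt, div_div_div_cancel_right₀ hsm.ne']

/-- Equation (38): closed-form evaluation of `∫_0^{π/2} 1/βₙ(θ) dθ`. -/
theorem betaN_integral (p0i p0j pij : ℝ) (hi : 0 < p0i) (hj : 0 < p0j)
    (hij : pij ^ 2 < p0i * p0j) :
    (∫ θ in (0 : ℝ)..(Real.pi / 2), 1 / betaN p0i p0j pij θ)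
      = Real.sqrt (p0i * p0j - pij ^ 2) *
          (Real.pi + 2 * Real.arcsin (pij / Real.sqrt (p0i * p0j))) := by
  have hD : 0 < p0i * p0j - pij ^ 2 := by linarith
  have hs : 0 < √(p0i * p0j - pij ^ 2) := Real.sqrt_pos.mpr hD
  have hcont : Continuous fun θ => 1 / betaN p0i p0j pij θ := by
    unfold betaN
    simp only [one_div_div]
    exact Continuous.div (by fun_prop) (by fun_prop) fun θ => (betaN_numerator_pos hi hij θ).ne'
  have hzero := (hasDerivAt_arctan_tan_primitive (θ := 0) hi hij
    (by simp)).continuousAt.continuousWithinAt (s := Set.Ioi 0)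
  have htop : Filter.Tendsto (fun x => 2 * √(p0i * p0j - pij ^ 2) *
      Real.arctan ((p0i * Real.tan x - pij) / √(p0i * p0j - pij ^ 2)))
      (nhdsWithin (π / 2) (Set.Iio (π / 2))) (nhds (2 * √(p0i * p0j - pij ^ 2) * (π / 2))) := by
    refine Filter.Tendsto.const_mul _
      ((Real.tendsto_arctan_atTop.mono_right nhdsWithin_le_nhds).comp ?_)
    refine Filter.Tendsto.atTop_div_const hs ?_
    simp only [sub_eq_add_neg]
    exact Filter.tendsto_atTop_add_const_right _ _
      (Real.tendsto_tan_pi_div_two.const_mul_atTop hi)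
  rw [intervalIntegral.integral_eq_sub_of_hasDerivAt_of_tendsto Real.pi_div_two_pos
    (fun θ hθ => hasDerivAt_arctan_tan_primitive hi hij
      (Real.cos_pos_of_mem_Ioo ⟨by linarith [hθ.1, Real.pi_pos], hθ.2⟩).ne')
    (hcont.intervalIntegrable _ _) hzero htop, arcsin_div_sqrt_eq_arctan hij]
  simp only [Real.tan_zero, mul_zero, zero_sub, neg_div, Real.arctan_neg]
  ring
end
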